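/- arXiv:1505.07784 — 5 statements merged into one kernel-verified Lean document; each statement's English description precedes it below -/
import Mathlib

section
/- Let H be an additive subgroup of ℝ and Δ ⊆ ℝⁿ an H-rational polyhedron. Then the monoid Aff_Δ is saturated (if F is an H-affine function and n·F ∈ Aff_Δ for some integer n ≥ 1, then F ∈ Aff_Δ) and is a cone over H: there exist finitely many F₁, …, F_m ∈ Aff_Δ such that every element of Aff_Δ can be written as c + Σⱼ kⱼ·Fⱼ with c ∈ H a constant function and kⱼ ∈ ℕ. -/
/-- An `H`-affine function on `ℝⁿ`: integer slope, constant term in `H`. -/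
def IsAffine (H : AddSubgroup ℝ) {n : ℕ} (F : (Fin n → ℝ) → ℝ) : Prop :=
  ∃ (a : Fin n → ℤ) (c : ℝ), c ∈ H ∧ ∀ x, F x = (∑ j, (a j : ℝ) * x j) + c

/-- `Aff_Δ`: the monoid of `H`-affine functions bounded above on `Δ`. -/
def AffOn (H : AddSubgroup ℝ) {n : ℕ} (Δ : Set (Fin n → ℝ)) : Set ((Fin n → ℝ) → ℝ) :=
  {F | IsAffine H F ∧ ∃ M : ℝ, ∀ x ∈ Δ, F x ≤ M}

/-- **Farkas' lemma**, for finitely many linear functionals over an ordered field. -/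
theorem LinearMap.exists_nonneg_combination_of_forall_nonpos {K W : Type*} [Field K]
    [LinearOrder K] [IsStrictOrderedRing K] [AddCommGroup W] [Module K W] {m : ℕ}
    (α : Fin m → W →ₗ[K] K) (γ : W →ₗ[K] K)
    (h : ∀ x, (∀ i, α i x ≤ 0) → γ x ≤ 0) :
    ∃ l : Fin m → K, (∀ i, 0 ≤ l i) ∧ γ = ∑ i, l i • α i := by
  induction m generalizing γ with
  | zero =>
    refine ⟨0, fun i => i.elim0, ?_⟩
    ext x
    have h₁ := h x fun i => i.elim0
    have h₂ := h (-x) fun i => i.elim0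
    rw [map_neg] at h₂
    simp only [Finset.univ_eq_empty, Finset.sum_empty, LinearMap.zero_apply]
    linarith
  | succ m ih =>
    by_cases hγ : ∀ x, (∀ i : Fin m, α i.castSucc x ≤ 0) → γ x ≤ 0
    · obtain ⟨l, hl, e⟩ := ih _ γ hγ
      refine ⟨Fin.snoc l 0, fun i => ?_, ?_⟩
      · refine Fin.lastCases ?_ (fun i => ?_) i <;> simp [hl]
      · simp [Fin.sum_univ_castSucc, e]
    · push Not at hγ
      obtain ⟨y, hy, hγy⟩ := hγ
      have hαy : 0 < α (Fin.last m) y := by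
        by_contra! hle
        exact hγy.not_ge (h y (Fin.lastCases hle hy))
      set t := α (Fin.last m) y with ht
      -- Project along `y` onto the kernel of the last functional.
      obtain ⟨l, hl, e⟩ := ih
        (fun i => α i.castSucc - (α i.castSucc y / t) • α (Fin.last m))
        (γ - (γ y / t) • α (Fin.last m)) (by
          intro x hx
          have key := h (x - (α (Fin.last m) x / t) • y) (by
            refine Fin.lastCases ?_ fun i => ?_
            · simp only [map_sub, map_smul, smul_eq_mul, ← ht]
              rw [div_mul_cancel₀ _ hαy.ne', sub_self]
            · have := hx i
              simp only [LinearMap.sub_apply, LinearMap.smul_apply, map_sub, map_smul,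
                smul_eq_mul] at this ⊢
              convert this using 2
              ring)
          simp only [LinearMap.sub_apply, LinearMap.smul_apply, map_sub, map_smul,
            smul_eq_mul] at key ⊢
          convert key using 2
          ring)
      refine ⟨Fin.snoc l ((γ y - ∑ i, l i * α i.castSucc y) / t), ?_, ?_⟩
      · refine Fin.lastCases ?_ fun i => ?_
        · rw [Fin.snoc_last]
          refine div_nonneg (sub_nonneg.2 (le_trans ?_ hγy.le)) hαy.le
          exact Finset.sum_nonpos fun i _ => mul_nonpos_of_nonneg_of_nonpos (hl i) (hy i)
        · simpa using hl i
      · ext x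
        have ex := LinearMap.congr_fun e x
        have hsum : ∑ i, l i * (α i.castSucc y / t * α (Fin.last m) x) =
            (∑ i, l i * α i.castSucc y) / t * α (Fin.last m) x := by
          rw [Finset.sum_div, Finset.sum_mul]
          exact Finset.sum_congr rfl fun i _ => by ring
        simp only [LinearMap.sum_apply, LinearMap.smul_apply, LinearMap.sub_apply, smul_eq_mul,
          mul_sub, Finset.sum_sub_distrib, hsum] at ex
        simp only [Fin.sum_univ_castSucc, Fin.snoc_castSucc, Fin.snoc_last, LinearMap.add_apply,
          LinearMap.sum_apply, LinearMap.smul_apply, smul_eq_mul, sub_div, sub_mul]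
        linarith

/-- The slope of an affine function bounded above on a nonempty polyhedron is a nonnegative
combination of the facet normals. -/
theorem exists_nonneg_combination_of_bounded {n m : ℕ} {a : Fin m → Fin n → ℝ} {b : Fin m → ℝ}
    {x₀ : Fin n → ℝ} (hx₀ : ∀ i, ∑ j, a i j * x₀ j ≤ b i) {s : Fin n → ℝ} {M : ℝ}
    (hs : ∀ x : Fin n → ℝ, (∀ i, ∑ j, a i j * x j ≤ b i) → ∑ j, s j * x j ≤ M) :
    ∃ l : Fin m → ℝ, (∀ i, 0 ≤ l i) ∧ ∀ j, s j = ∑ i, l i * a i j := by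
  let φ (v : Fin n → ℝ) : (Fin n → ℝ) →ₗ[ℝ] ℝ := ∑ j, v j • LinearMap.proj j
  have hφ (v x) : φ v x = ∑ j, v j * x j := by simp [φ]
  simp only [← hφ] at hx₀ hs
  obtain ⟨l, hl, e⟩ := LinearMap.exists_nonneg_combination_of_forall_nonpos (fun i => φ (a i))
    (φ s) (by
      intro y hy
      by_contra! hpos
      have hM := hs (x₀ + ((M - φ s x₀ + 1) / φ s y) • y) (by
        intro i
        rw [map_add, map_smul, smul_eq_mul]
        have h₀ : 0 ≤ (M - φ s x₀ + 1) / φ s y :=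
          div_nonneg (by linarith [hs x₀ hx₀]) hpos.le
        linarith [hx₀ i, mul_nonpos_of_nonneg_of_nonpos h₀ (hy i)])
      rw [map_add, map_smul, smul_eq_mul, div_mul_cancel₀ _ hpos.ne'] at hM
      linarith)
  refine ⟨l, hl, fun j => ?_⟩
  simpa [hφ, Pi.single_apply] using LinearMap.congr_fun e (Pi.single j 1)

/-- **Gordan's lemma**: an integral vector in the real cone spanned by integral vectors `a i` is an
`ℕ`-combination of the `a i` plus an integral vector of the cone lying in a fixed box. -/
theorem exists_nat_combination_add_of_nonneg_combination {n m : ℕ} {a : Fin m → Fin n → ℤ}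
    {s : Fin n → ℤ} {l : Fin m → ℝ} (hl : ∀ i, 0 ≤ l i)
    (hs : ∀ j, (s j : ℝ) = ∑ i, l i * a i j) :
    ∃ (k : Fin m → ℕ) (r : Fin n → ℤ), r ∈ Finset.Icc (-∑ i, |a i|) (∑ i, |a i|) ∧
      (∃ l' : Fin m → ℝ, (∀ i, 0 ≤ l' i) ∧ ∀ j, (r j : ℝ) = ∑ i, l' i * a i j) ∧
      s = ∑ i, k i • a i + r := by
  have hr (j) : ((s - ∑ i, ⌊l i⌋₊ • a i) j : ℝ) = ∑ i, (l i - ⌊l i⌋₊) * a i j := by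
    simp [hs, sub_mul, Finset.sum_apply]
  have hf₀ (i) : 0 ≤ l i - ⌊l i⌋₊ := sub_nonneg.2 (Nat.floor_le (hl i))
  have hf₁ (i) : l i - ⌊l i⌋₊ ≤ 1 := by linarith [Nat.lt_floor_add_one (l i)]
  refine ⟨fun i => ⌊l i⌋₊, s - ∑ i, ⌊l i⌋₊ • a i, ?_, ⟨_, hf₀, hr⟩, by abel⟩
  have hbox (j) : |(s - ∑ i, ⌊l i⌋₊ • a i) j| ≤ (∑ i, |a i|) j := by
    have : |((s - ∑ i, ⌊l i⌋₊ • a i) j : ℝ)| ≤ ∑ i, |(a i j : ℝ)| := by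
      rw [hr]
      refine (Finset.abs_sum_le_sum_abs _ _).trans (Finset.sum_le_sum fun i _ => ?_)
      rw [abs_mul, abs_of_nonneg (hf₀ i)]
      exact mul_le_of_le_one_left (abs_nonneg _) (hf₁ i)
    rw [Finset.sum_apply]
    simp only [Pi.abs_apply]
    exact_mod_cast this
  exact Finset.mem_Icc.2 ⟨fun j => (abs_le.1 (hbox j)).1, fun j => (abs_le.1 (hbox j)).2⟩

/-- For an `H`-rational polyhedron `Δ`, the monoid `Aff_Δ` is saturated and
is a cone over `H`: finitely generated over the constants in `H`. -/
theorem stmt_2 (H : AddSubgroup ℝ) (n m : ℕ) (a : Fin m → Fin n → ℤ)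
    (b : Fin m → ℝ) (hb : ∀ i, b i ∈ H)
    (Δ : Set (Fin n → ℝ))
    (hΔ : Δ = {x | ∀ i, (∑ j, (a i j : ℝ) * x j) ≤ b i})
    (hne : Δ.Nonempty) :
    (∀ F : (Fin n → ℝ) → ℝ, IsAffine H F →
      ∀ k : ℕ, 1 ≤ k → (fun x => (k : ℝ) * F x) ∈ AffOn H Δ → F ∈ AffOn H Δ) ∧
    (∃ (N : ℕ) (F : Fin N → ((Fin n → ℝ) → ℝ)),
      (∀ j, F j ∈ AffOn H Δ) ∧
      ∀ G ∈ AffOn H Δ, ∃ c : ℝ, c ∈ H ∧ ∃ k : Fin N → ℕ,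
        G = fun x => c + ∑ j, (k j : ℝ) * F j x) := by
  subst hΔ
  obtain ⟨x₀, hx₀⟩ := hne
  refine ⟨fun F hF k hk hkF => ⟨hF, ?_⟩, ?_⟩
  · obtain ⟨-, M, hM⟩ := hkF
    refine ⟨M / k, fun x hx => ?_⟩
    rw [le_div_iff₀' (by exact_mod_cast hk)]
    exact hM x hx
  let slopes : Set (Fin n → ℤ) :=
    {r | r ∈ Finset.Icc (-∑ i, |a i|) (∑ i, |a i|) ∧
      ∃ l : Fin m → ℝ, (∀ i, 0 ≤ l i) ∧ ∀ j, (r j : ℝ) = ∑ i, l i * a i j}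
  have : Finite slopes := ((Finset.finite_toSet _).subset fun r hr => hr.1 : slopes.Finite)
  have : Fintype slopes := Fintype.ofFinite _
  let e := Fintype.equivFin (Fin m ⊕ slopes)
  let g : Fin m ⊕ slopes → Fin n → ℤ := Sum.elim a Subtype.val
  have hg (p) : ∃ l : Fin m → ℝ, (∀ i, 0 ≤ l i) ∧ ∀ j, (g p j : ℝ) = ∑ i, l i * a i j := by
    rcases p with i | r
    · refine ⟨Pi.single i 1, fun i' => ?_, fun j => by simp [g, Pi.single_apply]⟩
      rw [Pi.single_apply]
      split_ifs <;> norm_num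
    · exact r.2.2
  refine ⟨_, fun p x => ∑ j, (g (e.symm p) j : ℝ) * x j,
    fun p => ⟨⟨_, 0, H.zero_mem, fun x => (add_zero _).symm⟩, ?_⟩, ?_⟩
  · obtain ⟨l, hl, hgl⟩ := hg (e.symm p)
    refine ⟨∑ i, l i * b i, fun x hx => ?_⟩
    simp only [hgl, Finset.sum_mul]
    rw [Finset.sum_comm]
    refine Finset.sum_le_sum fun i _ => ?_
    simp only [mul_assoc, ← Finset.mul_sum]
    exact mul_le_mul_of_nonneg_left (hx i) (hl i)
  rintro G ⟨⟨s, c, hc, hG⟩, M, hM⟩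
  obtain ⟨l, hl, hs⟩ := exists_nonneg_combination_of_bounded (M := M - c)
    (a := fun i j => (a i j : ℝ)) (s := fun j => (s j : ℝ)) hx₀ fun x hx => by
      linarith [hM x hx, hG x]
  obtain ⟨k, r, hr, hrl, hsr⟩ := exists_nat_combination_add_of_nonneg_combination hl hs
  classical
  let κ : Fin m ⊕ slopes → ℕ := Sum.elim k (Pi.single ⟨r, hr, hrl⟩ 1)
  refine ⟨c, hc, κ ∘ e.symm, funext fun x => ?_⟩
  have hsum : s = ∑ p, κ p • g p := by
    rw [hsr, Fintype.sum_sum_type]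
    simp [κ, g, Pi.single_apply]
  rw [hG, add_comm, add_right_inj, hsum]
  simp only [Function.comp_apply]
  rw [e.symm.sum_comp (fun p => (κ p : ℝ) * ∑ j, (g p j : ℝ) * x j)]
  simp only [Finset.sum_apply, Pi.smul_apply]
  simp only [nsmul_eq_mul, Int.cast_sum, Int.cast_mul, Int.cast_natCast, Finset.sum_mul,
    Finset.mul_sum, mul_assoc]
  exact Finset.sum_comm
end

section
/- Let H ⊆ H′ be additive subgroups of ℝ, and let Aff(ℝⁿ, H) denote the additive group of H-affine functions on ℝⁿ. The evaluation map sending x ∈ (H′)ⁿ to the homomorphism F ↦ F(x) is a bijection from (H′)ⁿ onto the set of additive group homomorphisms φ : Aff(ℝⁿ, H) → H′ such that φ(c) = c for every constant function c ∈ H. -/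
theorem isAffine_const {H : AddSubgroup ℝ} {n : ℕ} {c : ℝ} (hc : c ∈ H) :
    IsAffine H (fun _ : Fin n → ℝ => c) :=
  ⟨0, c, hc, by simp⟩

theorem isAffine_coord (H : AddSubgroup ℝ) {n : ℕ} (j : Fin n) :
    IsAffine H (fun x : Fin n → ℝ => x j) :=
  ⟨Pi.single j 1, 0, H.zero_mem, fun x => by simp [Pi.single_apply]⟩

/-- The additive group `Aff(ℝⁿ, H)` of `H`-affine functions. -/
def affineFunctions (H : AddSubgroup ℝ) (n : ℕ) : AddSubgroup ((Fin n → ℝ) → ℝ) where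
  carrier := {F | IsAffine H F}
  zero_mem' := isAffine_const H.zero_mem
  add_mem' := by
    rintro F G ⟨a, c, hc, hF⟩ ⟨b, d, hd, hG⟩
    refine ⟨a + b, c + d, H.add_mem hc hd, fun x => ?_⟩
    simp only [Pi.add_apply, hF, hG, Int.cast_add, add_mul, Finset.sum_add_distrib]
    ring
  neg_mem' := by
    rintro F ⟨a, c, hc, hF⟩
    refine ⟨-a, -c, H.neg_mem hc, fun x => ?_⟩
    simp only [Pi.neg_apply, hF, Int.cast_neg, neg_mul, Finset.sum_neg_distrib]
    ring

/-- The `j`-th coordinate as an element of `Aff(ℝⁿ, H)`. -/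
def affineCoord (H : AddSubgroup ℝ) {n : ℕ} (j : Fin n) : affineFunctions H n :=
  ⟨fun x => x j, isAffine_coord H j⟩

/-- A homomorphism on `Aff(ℝⁿ, H)` fixing constants is evaluation at the point whose coordinates
are the images of the coordinate functions. -/
theorem AddMonoidHom.eq_eval_of_fix_const {H : AddSubgroup ℝ} {n : ℕ}
    (ψ : affineFunctions H n →+ ℝ)
    (hψ : ∀ (c : ℝ) (hc : c ∈ H), ψ ⟨fun _ => c, isAffine_const hc⟩ = c)
    (F : affineFunctions H n) : ψ F = F.1 fun j => ψ (affineCoord H j) := by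
  obtain ⟨a, c, hc, hF⟩ := F.2
  have h : F = ∑ j, a j • affineCoord H j + ⟨fun _ => c, isAffine_const hc⟩ := by
    ext x
    simp [hF, affineCoord, Finset.sum_apply]
  rw [hF, h, map_add, map_sum, hψ c hc]
  simp only [map_zsmul, zsmul_eq_mul]

/-- for additive subgroups `H ≤ H'` of `ℝ`, evaluation is a bijection
from `(H')ⁿ` onto the set of additive homomorphisms `Aff(ℝⁿ, H) → H'` fixing the
constants in `H`. -/
theorem stmt_5 (H H' : AddSubgroup ℝ) (hHH' : H ≤ H') (n : ℕ) :
    -- evaluation at a point of `(H')ⁿ` is a homomorphism `Aff(ℝⁿ,H) → H'` fixing constants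
    (∀ x : Fin n → ℝ, (∀ j, x j ∈ H') → ∀ F : (Fin n → ℝ) → ℝ, IsAffine H F → F x ∈ H') ∧
    -- evaluation is injective on `(H')ⁿ`
    (∀ x y : Fin n → ℝ, (∀ j, x j ∈ H') → (∀ j, y j ∈ H') →
      (∀ F : (Fin n → ℝ) → ℝ, IsAffine H F → F x = F y) → x = y) ∧
    -- every such homomorphism is evaluation at a (unique) point of `(H')ⁿ`
    (∀ φ : ((Fin n → ℝ) → ℝ) → ℝ,
      (∀ F G : (Fin n → ℝ) → ℝ, IsAffine H F → IsAffine H G → φ (F + G) = φ F + φ G) →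
      (∀ F : (Fin n → ℝ) → ℝ, IsAffine H F → φ F ∈ H') →
      (∀ c : ℝ, c ∈ H → φ (fun _ => c) = c) →
      ∃ x : Fin n → ℝ, (∀ j, x j ∈ H') ∧
        ∀ F : (Fin n → ℝ) → ℝ, IsAffine H F → φ F = F x) := by
  refine ⟨?_, ?_, ?_⟩
  · rintro x hx F ⟨a, c, hc, hF⟩
    rw [hF]
    refine H'.add_mem (H'.sum_mem fun j _ => ?_) (hHH' hc)
    rw [← zsmul_eq_mul]
    exact H'.zsmul_mem (hx j) _
  · intro x y _ _ h
    exact funext fun j => h _ (isAffine_coord H j)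
  · intro φ hadd hmem hconst
    let ψ : affineFunctions H n →+ ℝ :=
      AddMonoidHom.mk' (fun F => φ F.1) fun F G => hadd F.1 G.1 F.2 G.2
    exact ⟨fun j => φ fun x => x j, fun j => hmem _ (isAffine_coord H j),
      fun F hF => ψ.eq_eval_of_fix_const hconst ⟨F, hF⟩⟩
end

section
/- Let H be an additive subgroup of ℝ and Δ ⊆ ℝⁿ an H-rational polyhedron which is strongly convex, in the sense that the subgroup of ℤⁿ generated by Λ_Δ is all of ℤⁿ. Then the evaluation map sending x to the homomorphism F ↦ F(x) is a bijection from Δ ∩ Hⁿ onto the set of additive monoid homomorphisms φ : Aff_Δ → H such that φ(c) = c for every constant function c ∈ H and φ(F) ≤ 0 for every F ∈ Aff⁺_Δ. -/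
/-- `Aff⁺_Δ`: the monoid of `H`-affine functions nonpositive on `Δ`. -/
def AffNonpos (H : AddSubgroup ℝ) {n : ℕ} (Δ : Set (Fin n → ℝ)) : Set ((Fin n → ℝ) → ℝ) :=
  {F | IsAffine H F ∧ ∀ x ∈ Δ, F x ≤ 0}

/-- An additive map defined on a submonoid generating a commutative group extends to the group. -/
theorem AddSubmonoid.exists_addMonoidHom_extend {A B : Type*} [AddCommGroup A] [AddCommGroup B]
    (M : AddSubmonoid A) (hM : AddSubgroup.closure (M : Set A) = ⊤) (f : A → B)
    (hf : ∀ u ∈ M, ∀ v ∈ M, f (u + v) = f u + f v) :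
    ∃ g : A →+ B, (∀ u ∈ M, g u = f u) ∧ ∀ w, ∃ p ∈ M, ∃ q ∈ M, g w = f p - f q := by
  have hdiff : ∀ w : A, ∃ p ∈ M, ∃ q ∈ M, w + q = p := by
    intro w
    have hw : w ∈ AddSubgroup.closure (M : Set A) := hM ▸ AddSubgroup.mem_top w
    induction hw using AddSubgroup.closure_induction with
    | mem x hx => exact ⟨x, hx, 0, M.zero_mem, add_zero x⟩
    | zero => exact ⟨0, M.zero_mem, 0, M.zero_mem, add_zero 0⟩
    | add x y _ _ ihx ihy =>
      obtain ⟨p, hp, q, hq, hx⟩ := ihx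
      obtain ⟨p', hp', q', hq', hy⟩ := ihy
      exact ⟨p + p', M.add_mem hp hp', q + q', M.add_mem hq hq', by rw [← hx, ← hy]; abel⟩
    | neg x _ ihx =>
      obtain ⟨p, hp, q, hq, hx⟩ := ihx
      exact ⟨q, hq, p, hp, by rw [← hx]; abel⟩
  choose p hp q hq hpq using hdiff
  refine ⟨AddMonoidHom.mk' (fun w => f (p w) - f (q w)) fun v w => ?_, fun u hu => ?_,
    fun w => ⟨p w, hp w, q w, hq w, rfl⟩⟩
  · have h : p (v + w) + (q v + q w) = q (v + w) + (p v + p w) := by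
      rw [← hpq (v + w), ← hpq v, ← hpq w]; abel
    have h' := congrArg f h
    rw [hf _ (hp _) _ (M.add_mem (hq v) (hq w)), hf _ (hq _) _ (M.add_mem (hp v) (hp w)),
      hf _ (hq v) _ (hq w), hf _ (hp v) _ (hp w)] at h'
    rw [sub_add_sub_comm, sub_eq_sub_iff_add_eq_add, h', add_comm]
  · change f (p u) - f (q u) = f u
    rw [← hpq u, hf u hu _ (hq u), add_sub_cancel_right]

/-- The monoid `Λ_Δ` of integer vectors whose linear functional is bounded above on `Δ`. -/
def boundedSlopes {n : ℕ} (Δ : Set (Fin n → ℝ)) : AddSubmonoid (Fin n → ℤ) where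
  carrier := {v | ∃ M : ℝ, ∀ x ∈ Δ, (∑ j, (v j : ℝ) * x j) ≤ M}
  zero_mem' := ⟨0, fun x _ => by simp⟩
  add_mem' := by
    rintro u v ⟨M, hM⟩ ⟨N, hN⟩
    refine ⟨M + N, fun x hx => ?_⟩
    simpa [add_mul, Finset.sum_add_distrib] using add_le_add (hM x hx) (hN x hx)

theorem sum_intCast_mul_mem (H : AddSubgroup ℝ) {n : ℕ} (v : Fin n → ℤ) {x : Fin n → ℝ}
    (hx : ∀ j, x j ∈ H) : (∑ j, (v j : ℝ) * x j) ∈ H :=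
  H.sum_mem fun j _ => by simpa using H.zsmul_mem (hx j) (v j)

theorem AddMonoidHom.eq_sum_intCast_mul {n : ℕ} (g : (Fin n → ℤ) →+ ℝ) (v : Fin n → ℤ) :
    g v = ∑ j, (v j : ℝ) * g (Pi.single j 1) := by
  conv_lhs => rw [← Finset.univ_sum_single v]
  rw [map_sum]
  refine Finset.sum_congr rfl fun j _ => ?_
  rw [← zsmul_eq_mul, ← map_zsmul, ← Pi.single_smul, smul_eq_mul, mul_one]

theorem linear_mem_affOn (H : AddSubgroup ℝ) {n : ℕ} {Δ : Set (Fin n → ℝ)} {v : Fin n → ℤ}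
    (hv : v ∈ boundedSlopes Δ) : (fun x => ∑ j, (v j : ℝ) * x j) ∈ AffOn H Δ :=
  ⟨⟨v, 0, H.zero_mem, fun _ => (add_zero _).symm⟩, hv⟩

theorem const_mem_affOn {H : AddSubgroup ℝ} {n : ℕ} (Δ : Set (Fin n → ℝ)) {c : ℝ} (hc : c ∈ H) :
    (fun _ => c) ∈ AffOn H Δ :=
  ⟨⟨0, c, hc, fun _ => by simp⟩, c, fun _ _ => le_rfl⟩

/-- for a strongly convex `H`-rational polyhedron `Δ`, evaluation is a
bijection from `Δ ∩ Hⁿ` onto the set of additive monoid homomorphisms `Aff_Δ → H`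
fixing the constants of `H` and nonpositive on `Aff⁺_Δ`. -/
theorem stmt_6 (H : AddSubgroup ℝ) (n m : ℕ) (a : Fin m → Fin n → ℤ)
    (b : Fin m → ℝ) (hb : ∀ i, b i ∈ H)
    (Δ : Set (Fin n → ℝ))
    (hΔ : Δ = {x | ∀ i, (∑ j, (a i j : ℝ) * x j) ≤ b i})
    (hne : Δ.Nonempty)
    (hsc : AddSubgroup.closure
        {v : Fin n → ℤ | ∃ M : ℝ, ∀ x ∈ Δ, (∑ j, (v j : ℝ) * x j) ≤ M} = ⊤) :
    -- evaluation at a point of `Δ ∩ Hⁿ` is a homomorphism `Aff_Δ → H` of the required kind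
    (∀ x ∈ Δ, (∀ j, x j ∈ H) →
      (∀ F ∈ AffOn H Δ, F x ∈ H) ∧ (∀ F ∈ AffNonpos H Δ, F x ≤ 0)) ∧
    -- evaluation is injective on `Δ ∩ Hⁿ`
    (∀ x ∈ Δ, ∀ y ∈ Δ, (∀ j, x j ∈ H) → (∀ j, y j ∈ H) →
      (∀ F ∈ AffOn H Δ, F x = F y) → x = y) ∧
    -- every such homomorphism is evaluation at a point of `Δ ∩ Hⁿ`
    (∀ φ : ((Fin n → ℝ) → ℝ) → ℝ,
      (∀ F ∈ AffOn H Δ, ∀ G ∈ AffOn H Δ, φ (F + G) = φ F + φ G) →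
      (∀ F ∈ AffOn H Δ, φ F ∈ H) →
      (∀ c : ℝ, c ∈ H → φ (fun _ => c) = c) →
      (∀ F ∈ AffNonpos H Δ, φ F ≤ 0) →
      ∃ x ∈ Δ, (∀ j, x j ∈ H) ∧ ∀ F ∈ AffOn H Δ, φ F = F x) := by
  subst hΔ
  set Δ : Set (Fin n → ℝ) := {x | ∀ i, (∑ j, (a i j : ℝ) * x j) ≤ b i} with hΔ
  change AddSubgroup.closure (boundedSlopes Δ : Set (Fin n → ℤ)) = ⊤ at hsc
  refine ⟨fun x hx hxH => ⟨?_, fun F hF => hF.2 x hx⟩, ?_, ?_⟩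
  · rintro F ⟨⟨v, c, hc, hF⟩, -⟩
    rw [hF]
    exact H.add_mem (sum_intCast_mul_mem H v hxH) hc
  · intro x _ y _ _ _ hxy
    let pairing (z : Fin n → ℝ) : (Fin n → ℤ) →+ ℝ :=
      AddMonoidHom.mk' (fun v => ∑ j, (v j : ℝ) * z j) fun u v => by
        simp [add_mul, Finset.sum_add_distrib]
    have heq : pairing x = pairing y :=
      AddMonoidHom.eq_of_eqOn_dense hsc fun v hv => hxy _ (linear_mem_affOn H hv)
    funext j
    simpa [pairing, Pi.single_apply] using DFunLike.congr_fun heq (Pi.single j 1)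
  · intro φ hadd hH hconst hneg
    obtain ⟨g, hg, hgdiff⟩ := (boundedSlopes Δ).exists_addMonoidHom_extend hsc
      (fun v => φ fun x => ∑ j, (v j : ℝ) * x j) fun u hu v hv => by
        rw [← hadd _ (linear_mem_affOn H hu) _ (linear_mem_affOn H hv)]
        congr 1
        funext x
        simp [add_mul, Finset.sum_add_distrib]
    have hφ : ∀ F ∈ AffOn H Δ, φ F = F fun j => g (Pi.single j 1) := by
      rintro F ⟨⟨v, c, hc, hF⟩, M, hM⟩
      have hv : v ∈ boundedSlopes Δ :=
        ⟨M - c, fun x hx => by linarith [hF x, hM x hx]⟩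
      have hsplit : F = (fun x => ∑ j, (v j : ℝ) * x j) + fun _ => c := funext hF
      rw [hF, ← g.eq_sum_intCast_mul, hg v hv, hsplit,
        hadd _ (linear_mem_affOn H hv) _ (const_mem_affOn Δ hc), hconst c hc]
    refine ⟨fun j => g (Pi.single j 1), fun i => ?_, fun j => ?_, hφ⟩
    · let F : (Fin n → ℝ) → ℝ := fun x => (∑ j, (a i j : ℝ) * x j) + -b i
      have haff : IsAffine H F := ⟨a i, -b i, H.neg_mem (hb i), fun _ => rfl⟩
      have hF : ∀ x ∈ Δ, F x ≤ 0 := fun x hx => by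
        have := hx i
        simp only [F]
        linarith
      have h := hneg F ⟨haff, hF⟩
      rw [hφ F ⟨haff, 0, hF⟩] at h
      simp only [F] at h
      linarith
    · obtain ⟨p, hp, q, hq, h⟩ := hgdiff (Pi.single j 1)
      simp only [h]
      exact H.sub_mem (hH _ (linear_mem_affOn H hp)) (hH _ (linear_mem_affOn H hq))
end

section
/- Let H be an additive subgroup of ℝ and Δ ⊆ ℝⁿ an H-rational polyhedron. Suppose Aff⁺_Δ is generated as a monoid by the nonpositive constant functions {c ∈ H : c ≤ 0} together with finitely many elements F₁, …, F_k. Then Δ = ⋂_{i=1}^{k} {x ∈ ℝⁿ : Fᵢ(x) ≤ 0}: the generators cut out Δ as an intersection of half-spaces. -/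
/-- if `Aff⁺_Δ` is generated as a monoid by the nonpositive constants in `H`
together with `F₁, …, F_k`, then the `Fᵢ` cut out `Δ` as an intersection of half-spaces. -/
theorem stmt_7 (H : AddSubgroup ℝ) (n m k : ℕ) (a : Fin m → Fin n → ℤ)
    (b : Fin m → ℝ) (hb : ∀ i, b i ∈ H)
    (Δ : Set (Fin n → ℝ))
    (hΔ : Δ = {x | ∀ i, (∑ j, (a i j : ℝ) * x j) ≤ b i})
    (hne : Δ.Nonempty)
    (F : Fin k → ((Fin n → ℝ) → ℝ))
    (hF : ∀ i, F i ∈ AffNonpos H Δ)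
    (hgen : ∀ G ∈ AffNonpos H Δ, ∃ c : ℝ, c ∈ H ∧ c ≤ 0 ∧ ∃ N : Fin k → ℕ,
      G = fun x => c + ∑ i, (N i : ℝ) * F i x) :
    Δ = ⋂ i : Fin k, {x : Fin n → ℝ | F i x ≤ 0} := by
  ext x
  simp only [Set.mem_iInter, Set.mem_ofPred_eq]
  refine ⟨fun hx i => (hF i).2 x hx, fun hx => ?_⟩
  rw [hΔ]
  intro i
  obtain ⟨c, -, hc, N, hN⟩ := hgen (fun y => (∑ j, (a i j : ℝ) * y j) + -b i)
    ⟨⟨a i, -b i, H.neg_mem (hb i), fun _ => rfl⟩, fun y hy => by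
      rw [hΔ] at hy
      linarith [hy i]⟩
  have hsum : ∑ l, (N l : ℝ) * F l x ≤ 0 :=
    Finset.sum_nonpos fun l _ => mul_nonpos_of_nonneg_of_nonpos (Nat.cast_nonneg _) (hx l)
  have hGx : (∑ j, (a i j : ℝ) * x j) + -b i = c + ∑ l, (N l : ℝ) * F l x := congrFun hN x
  linarith
end

section
/- Let H be an additive subgroup of ℝ and Δ ⊆ ℝⁿ an H-rational polyhedron. Every face of the monoid Aff_Δ contains all constant functions c ∈ H, and the slope map d : Aff_Δ → Λ_Δ, F ↦ dF, induces an inclusion-preserving bijection between the set of faces of Aff_Δ and the set of faces of Λ_Δ: it sends a face σ of Aff_Δ to its image d(σ), which is a face of Λ_Δ, its inverse sends a face τ of Λ_Δ to the preimage d⁻¹(τ), and every face σ of Aff_Δ satisfies σ = d⁻¹(d(σ)). -/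
/-- `σ` is a face of the (sub)monoid `Q` of an ambient commutative monoid:
a submonoid of `Q` such that `X + Y ∈ σ ↔ X ∈ σ ∧ Y ∈ σ` for `X, Y ∈ Q`. -/
def IsFaceIn {M : Type*} [AddCommMonoid M] (Q σ : Set M) : Prop :=
  σ ⊆ Q ∧ (0 : M) ∈ σ ∧ (∀ X ∈ σ, ∀ Y ∈ σ, X + Y ∈ σ) ∧
    ∀ X ∈ Q, ∀ Y ∈ Q, (X + Y ∈ σ ↔ X ∈ σ ∧ Y ∈ σ)

/-- The linear function `x ↦ ⟨v, x⟩` with integer slope `v`, additively in `v`. -/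
def slopeFun (n : ℕ) : (Fin n → ℤ) →+ ((Fin n → ℝ) → ℝ) where
  toFun v x := ∑ j, (v j : ℝ) * x j
  map_zero' := by ext x; simp
  map_add' v w := by ext x; simp [add_mul, Finset.sum_add_distrib]

theorem slopeFun_apply {n : ℕ} (v : Fin n → ℤ) (x : Fin n → ℝ) :
    slopeFun n v x = ∑ j, (v j : ℝ) * x j := rfl

/-- The slope of an affine function is determined by the function. -/
theorem slope_eq_of_slopeFun_add_const_eq {n : ℕ} {v w : Fin n → ℤ} {c c' : ℝ}
    (h : ∀ x, slopeFun n v x + c = slopeFun n w x + c') : v = w := by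
  have h0 := h 0
  simp only [slopeFun_apply, Pi.zero_apply, mul_zero, Finset.sum_const_zero, zero_add] at h0
  ext j
  have hj := h (Pi.single j 1)
  simp only [slopeFun_apply, Pi.single_apply, mul_ite, mul_one, mul_zero, Finset.sum_ite_eq',
    Finset.mem_univ, if_true, h0, add_left_inj] at hj
  exact_mod_cast hj

theorem IsAffine.add {H : AddSubgroup ℝ} {n : ℕ} {F G : (Fin n → ℝ) → ℝ}
    (hF : IsAffine H F) (hG : IsAffine H G) : IsAffine H (F + G) := by
  obtain ⟨v, c, hc, hv⟩ := hF
  obtain ⟨w, e, he, hw⟩ := hG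
  refine ⟨v + w, c + e, H.add_mem hc he, fun x => ?_⟩
  rw [← slopeFun_apply, map_add, Pi.add_apply, Pi.add_apply, hv, hw, slopeFun_apply,
    slopeFun_apply]
  ring

theorem add_mem_affOn {H : AddSubgroup ℝ} {n : ℕ} {Δ : Set (Fin n → ℝ)} {F G : (Fin n → ℝ) → ℝ}
    (hF : F ∈ AffOn H Δ) (hG : G ∈ AffOn H Δ) : F + G ∈ AffOn H Δ := by
  obtain ⟨hF, M, hM⟩ := hF
  obtain ⟨hG, N, hN⟩ := hG
  exact ⟨hF.add hG, M + N, fun x hx => add_le_add (hM x hx) (hN x hx)⟩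

theorem isAffine_slopeFun (H : AddSubgroup ℝ) {n : ℕ} (v : Fin n → ℤ) :
    IsAffine H (slopeFun n v) :=
  ⟨v, 0, H.zero_mem, fun x => by rw [add_zero, slopeFun_apply]⟩

theorem IsFaceIn.const_mem {H : AddSubgroup ℝ} {n : ℕ} {Δ : Set (Fin n → ℝ)}
    {σ : Set ((Fin n → ℝ) → ℝ)} (hσ : IsFaceIn (AffOn H Δ) σ) {c : ℝ} (hc : c ∈ H) :
    (fun _ => c) ∈ σ := by
  refine ((hσ.2.2.2 _ (const_mem_affOn Δ hc) _ (const_mem_affOn Δ (H.neg_mem hc))).1 ?_).1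
  convert hσ.2.1 using 1
  ext x
  simp

/-- every face of `Aff_Δ` contains the constants of `H`, and the slope
map `d` induces an inclusion-preserving bijection between faces of `Aff_Δ` and faces
of `Λ_Δ`. -/
theorem stmt_10 (H : AddSubgroup ℝ) (n m : ℕ) (a : Fin m → Fin n → ℤ)
    (b : Fin m → ℝ) (hb : ∀ i, b i ∈ H)
    (Δ : Set (Fin n → ℝ))
    (hΔ : Δ = {x | ∀ i, (∑ j, (a i j : ℝ) * x j) ≤ b i})
    (hne : Δ.Nonempty)
    (Λ : Set (Fin n → ℤ))
    (hΛ : Λ = {v | ∃ M : ℝ, ∀ x ∈ Δ, (∑ j, (v j : ℝ) * x j) ≤ M})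
    (d : ((Fin n → ℝ) → ℝ) → (Fin n → ℤ))
    (hd : ∀ F : (Fin n → ℝ) → ℝ, IsAffine H F →
      ∃ c ∈ H, ∀ x, F x = (∑ j, (d F j : ℝ) * x j) + c) :
    (∀ σ : Set ((Fin n → ℝ) → ℝ), IsFaceIn (AffOn H Δ) σ →
      (∀ c : ℝ, c ∈ H → (fun _ => c) ∈ σ) ∧
      IsFaceIn Λ (d '' σ) ∧
      σ = {F ∈ AffOn H Δ | d F ∈ d '' σ}) ∧
    (∀ τ : Set (Fin n → ℤ), IsFaceIn Λ τ →
      IsFaceIn (AffOn H Δ) {F ∈ AffOn H Δ | d F ∈ τ} ∧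
      d '' {F ∈ AffOn H Δ | d F ∈ τ} = τ) ∧
    (∀ σ₁ σ₂ : Set ((Fin n → ℝ) → ℝ),
      IsFaceIn (AffOn H Δ) σ₁ → IsFaceIn (AffOn H Δ) σ₂ →
      (σ₁ ⊆ σ₂ ↔ d '' σ₁ ⊆ d '' σ₂)) := by
  have d_eq : ∀ {F v c}, IsAffine H F → (∀ x, F x = slopeFun n v x + c) → d F = v := by
    intro F v c hF h
    obtain ⟨e, -, he⟩ := hd F hF
    exact slope_eq_of_slopeFun_add_const_eq fun x => (he x).symm.trans (h x)
  have d_slope : ∀ v, d (slopeFun n v) = v := fun v =>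
    d_eq (c := 0) (isAffine_slopeFun H v) fun x => (add_zero _).symm
  have d_add : ∀ {F G}, IsAffine H F → IsAffine H G → d (F + G) = d F + d G := by
    intro F G hF hG
    obtain ⟨c, -, hc⟩ := hd F hF
    obtain ⟨e, -, he⟩ := hd G hG
    refine d_eq (c := c + e) (hF.add hG) fun x => ?_
    rw [map_add, Pi.add_apply, Pi.add_apply, hc, he, slopeFun_apply, slopeFun_apply]
    ring
  have slope_mem : ∀ {v}, v ∈ Λ → slopeFun n v ∈ AffOn H Δ := by
    intro v hv
    rw [hΛ] at hv
    exact ⟨isAffine_slopeFun H v, hv⟩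
  have d_mem : ∀ {F}, F ∈ AffOn H Δ → d F ∈ Λ := by
    rintro F ⟨hF, M, hM⟩
    obtain ⟨c, -, hc⟩ := hd F hF
    rw [hΛ]
    refine ⟨M - c, fun x hx => ?_⟩
    linarith [hM x hx, hc x]
  have mem_iff : ∀ {σ}, IsFaceIn (AffOn H Δ) σ → ∀ {F}, F ∈ AffOn H Δ →
      (F ∈ σ ↔ slopeFun n (d F) ∈ σ) := by
    intro σ hσ F hF
    obtain ⟨c, hc, hFc⟩ := hd F hF.1
    have hsum : F = slopeFun n (d F) + fun _ => c := funext hFc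
    have key := hσ.2.2.2 _ (slope_mem (d_mem hF)) _ (const_mem_affOn Δ hc)
    rw [← hsum] at key
    exact key.trans (and_iff_left (hσ.const_mem hc))
  have mem_image : ∀ {σ}, IsFaceIn (AffOn H Δ) σ → ∀ {v},
      (v ∈ d '' σ ↔ slopeFun n v ∈ σ) := by
    intro σ hσ v
    constructor
    · rintro ⟨F, hF, rfl⟩
      exact (mem_iff hσ (hσ.1 hF)).1 hF
    · exact fun h => ⟨_, h, d_slope v⟩
  have eq_preimage : ∀ {σ}, IsFaceIn (AffOn H Δ) σ →
      σ = {F ∈ AffOn H Δ | d F ∈ d '' σ} := by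
    intro σ hσ
    ext F
    refine ⟨fun hF => ⟨hσ.1 hF, F, hF, rfl⟩, fun hF => ?_⟩
    exact (mem_iff hσ hF.1).2 ((mem_image hσ).1 hF.2)
  refine ⟨fun σ hσ => ⟨fun c hc => hσ.const_mem hc, ⟨?_, ?_, ?_, ?_⟩, eq_preimage hσ⟩,
    fun τ hτ => ⟨⟨fun F hF => hF.1, ?_, ?_, ?_⟩, ?_⟩, fun σ₁ σ₂ h₁ h₂ => ⟨Set.image_mono, ?_⟩⟩
  · rintro _ ⟨F, hF, rfl⟩
    exact d_mem (hσ.1 hF)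
  · rw [mem_image hσ, map_zero]
    exact hσ.2.1
  · intro v hv w hw
    rw [mem_image hσ] at hv hw ⊢
    rw [map_add]
    exact hσ.2.2.1 _ hv _ hw
  · intro v hv w hw
    rw [mem_image hσ, mem_image hσ, mem_image hσ, map_add]
    exact hσ.2.2.2 _ (slope_mem hv) _ (slope_mem hw)
  · refine ⟨const_mem_affOn Δ H.zero_mem, ?_⟩
    rw [← map_zero (slopeFun n), d_slope]
    exact hτ.2.1
  · intro F hF G hG
    refine ⟨add_mem_affOn hF.1 hG.1, ?_⟩
    rw [d_add hF.1.1 hG.1.1]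
    exact hτ.2.2.1 _ hF.2 _ hG.2
  · intro F hF G hG
    have key := hτ.2.2.2 _ (d_mem hF) _ (d_mem hG)
    rw [← d_add hF.1 hG.1] at key
    simp only [Set.mem_ofPred_eq, key, add_mem_affOn hF hG, hF, hG, true_and]
  · ext v
    constructor
    · rintro ⟨F, hF, rfl⟩
      exact hF.2
    · intro hv
      refine ⟨slopeFun n v, ⟨slope_mem (hτ.1 hv), ?_⟩, d_slope v⟩
      rwa [d_slope]
  · intro h
    rw [eq_preimage h₁, eq_preimage h₂]
    exact fun F hF => ⟨hF.1, h hF.2⟩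
end
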